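/- arXiv:1806.03926 — 3 statements merged into one kernel-verified Lean document; each statement's English description precedes it below -/
import Mathlib

section
/- Let A ≥ 0 and B ≥ 0. Then the function T ↦ √((T + A)(T + B)) on (0,∞) has a completely monotone derivative; i.e., the function T ↦ (2T + A + B)/(2·√((T + A)(T + B))) is completely monotone on (0,∞). -/
open MeasureTheory Real

noncomputable section

/-- `g` is completely monotone on `(0,∞)`:  infinitely differentiable with
`(-1)^n g^(n)(T) ≥ 0` for all `T > 0` and `n ≥ 0`. -/
def CompletelyMonotoneOn (g : ℝ → ℝ) : Prop :=
  ContDiffOn ℝ (⊤ : ℕ∞) g (Set.Ioi 0) ∧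
  ∀ (n : ℕ) (T : ℝ), 0 < T →
    0 ≤ (-1 : ℝ) ^ n * iteratedDerivWithin n g (Set.Ioi 0) T

end

namespace CompletelyMonotoneOn

/-- The `n`-th sign condition of a product follows from those of the factors up to order `n`. -/
lemma sign_mul {f g : ℝ → ℝ} (hf : ContDiffOn ℝ (⊤ : ℕ∞) f (Set.Ioi 0))
    (hg : ContDiffOn ℝ (⊤ : ℕ∞) g (Set.Ioi 0)) {n : ℕ} {T : ℝ} (hT : 0 < T)
    (hfn : ∀ k ≤ n, 0 ≤ (-1 : ℝ) ^ k * iteratedDerivWithin k f (Set.Ioi 0) T)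
    (hgn : ∀ k ≤ n, 0 ≤ (-1 : ℝ) ^ k * iteratedDerivWithin k g (Set.Ioi 0) T) :
    0 ≤ (-1 : ℝ) ^ n * iteratedDerivWithin n (f * g) (Set.Ioi 0) T := by
  have hn : ((n : ℕ∞) : WithTop ℕ∞) ≤ ((⊤ : ℕ∞) : WithTop ℕ∞) := by exact_mod_cast le_top
  rw [iteratedDerivWithin_mul (Set.mem_Ioi.2 hT) (uniqueDiffOn_Ioi 0)
    ((hf T hT).of_le hn) ((hg T hT).of_le hn), Finset.mul_sum]
  refine Finset.sum_nonneg fun i hi => ?_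
  have hi : i ≤ n := Nat.lt_succ_iff.1 (Finset.mem_range.1 hi)
  have hsign : (-1 : ℝ) ^ n = (-1) ^ i * (-1) ^ (n - i) := by
    rw [← pow_add, Nat.add_sub_cancel' hi]
  have h := mul_nonneg (Nat.cast_nonneg (α := ℝ) (n.choose i))
    (mul_nonneg (hfn i hi) (hgn (n - i) (Nat.sub_le n i)))
  rw [hsign]
  linarith

lemma mul {f g : ℝ → ℝ} (hf : CompletelyMonotoneOn f) (hg : CompletelyMonotoneOn g) :
    CompletelyMonotoneOn (f * g) :=
  ⟨hf.1.mul hg.1, fun _ T hT =>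
    sign_mul hf.1 hg.1 hT (fun k _ => hf.2 k T hT) (fun k _ => hg.2 k T hT)⟩

lemma const {c : ℝ} (hc : 0 ≤ c) : CompletelyMonotoneOn (fun _ => c) := by
  refine ⟨contDiffOn_const, fun n T _ => ?_⟩
  cases n with
  | zero => simpa using hc
  | succ n => simp [iteratedDerivWithin_const]

/-- A nonnegative solution of `g' = -ψ g` is completely monotone as soon as each sign condition
for `ψ` follows from those for `g` up to the same order. -/
lemma of_hasDerivAt {g ψ : ℝ → ℝ} (hg : ContDiffOn ℝ (⊤ : ℕ∞) g (Set.Ioi 0))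
    (hψ : ContDiffOn ℝ (⊤ : ℕ∞) ψ (Set.Ioi 0)) (hpos : ∀ T, 0 < T → 0 ≤ g T)
    (hderiv : ∀ T, 0 < T → HasDerivAt g (-(ψ T * g T)) T)
    (hsign : ∀ (n : ℕ) (T : ℝ), 0 < T →
      0 ≤ (-1 : ℝ) ^ n * iteratedDerivWithin n g (Set.Ioi 0) T →
      0 ≤ (-1 : ℝ) ^ n * iteratedDerivWithin n ψ (Set.Ioi 0) T) :
    CompletelyMonotoneOn g := by
  refine ⟨hg, fun n T hT => ?_⟩
  induction n using Nat.strong_induction_on with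
  | _ n ih =>
    cases n with
    | zero => simpa using hpos T hT
    | succ n =>
      have heq : Set.EqOn (derivWithin g (Set.Ioi 0)) (-(ψ * g)) (Set.Ioi 0) := fun x hx =>
        (hderiv x hx).hasDerivWithinAt.derivWithin (uniqueDiffOn_Ioi 0 x hx)
      have h := sign_mul hψ hg hT
        (fun k hk => hsign k T hT (ih k (Nat.lt_succ_of_le hk)))
        (fun k hk => ih k (Nat.lt_succ_of_le hk))
      rw [iteratedDerivWithin_succ', iteratedDerivWithin_congr heq (Set.mem_Ioi.2 hT),
        iteratedDerivWithin_neg, pow_succ]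
      linarith

lemma inv_add {c : ℝ} (hc : 0 ≤ c) : CompletelyMonotoneOn (fun T => (T + c)⁻¹) := by
  have hne : ∀ T ∈ Set.Ioi (0 : ℝ), T + c ≠ 0 := fun T hT =>
    (add_pos_of_pos_of_nonneg hT hc).ne'
  have hsmooth : ContDiffOn ℝ (⊤ : ℕ∞) (fun T => (T + c)⁻¹) (Set.Ioi 0) :=
    (contDiffOn_id.add contDiffOn_const).inv hne
  refine of_hasDerivAt hsmooth hsmooth
    (fun T hT => inv_nonneg.2 (add_pos_of_pos_of_nonneg hT hc).le) (fun T hT => ?_)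
    (fun _ _ _ h => h)
  have hT' := hne T hT
  refine (((hasDerivAt_id T).add_const c).fun_inv hT').congr_deriv ?_
  simp only [id]
  field_simp

end CompletelyMonotoneOn

theorem sqrt_prod_has_CM_deriv (A B : ℝ) (hA : 0 ≤ A) (hB : 0 ≤ B) :
    CompletelyMonotoneOn (fun T =>
      (2 * T + A + B) / (2 * Real.sqrt ((T + A) * (T + B)))) := by
  -- the negative logarithmic derivative of the function is completely monotone
  have hψ : CompletelyMonotoneOn ((fun _ => (A - B) ^ 2 / 4) *
      ((fun T => (T + (A + B) / 2)⁻¹) * ((fun T => (T + A)⁻¹) * (fun T => (T + B)⁻¹)))) :=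
    (CompletelyMonotoneOn.const (by positivity)).mul
      ((CompletelyMonotoneOn.inv_add (by positivity)).mul
        ((CompletelyMonotoneOn.inv_add hA).mul (CompletelyMonotoneOn.inv_add hB)))
  have hprod : ∀ T : ℝ, 0 < T → 0 < (T + A) * (T + B) := fun T hT => by positivity
  refine CompletelyMonotoneOn.of_hasDerivAt ?_ hψ.1 (fun T hT => by positivity)
    (fun T hT => ?_) (fun n T hT _ => hψ.2 n T hT)
  · refine ContDiffOn.div (by fun_prop) (contDiffOn_const.mul (ContDiffOn.sqrt (by fun_prop)
      fun T hT => (hprod T hT).ne')) fun T hT => ?_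
    have := Real.sqrt_pos.2 (hprod T hT)
    positivity
  · have hr := Real.sqrt_pos.2 (hprod T hT)
    have hsq := Real.sq_sqrt (hprod T hT).le
    have hnum : HasDerivAt (fun T : ℝ => 2 * T + A + B) 2 T := by
      simpa using (((hasDerivAt_id T).const_mul 2).add_const A).add_const B
    have hP : HasDerivAt (fun T : ℝ => (T + A) * (T + B)) (2 * T + A + B) T :=
      (((hasDerivAt_id T).add_const A).fun_mul ((hasDerivAt_id T).add_const B)).congr_deriv
        (by simp only [id]; ring)
    refine (hnum.fun_div ((hP.sqrt (hprod T hT).ne').const_mul 2) (by positivity)).congr_deriv ?_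
    have hinv : (T + A)⁻¹ * (T + B)⁻¹ = (√((T + A) * (T + B)) ^ 2)⁻¹ := by rw [hsq, mul_inv]
    simp only [Pi.mul_apply]
    rw [hinv]
    have hm : 0 < T + (A + B) / 2 := by positivity
    have hm2 : 2 * T + A + B = 2 * (T + (A + B) / 2) := by ring
    rw [hm2]
    set r := √((T + A) * (T + B))
    set m := T + (A + B) / 2 with hmdef
    have hr2 : r ^ 2 = m ^ 2 - (A - B) ^ 2 / 4 := by rw [hsq, hmdef]; ring
    field_simp
    rw [hr2]
    ring
end

section
/- Let k > 0, a > 1 and b > 1, and define J_k(t) = ∫_{1/b}^{b} ((b − v)(v − 1/b)/((v + ta)(v + t/a)))^k · t^k/((b − v)(v − 1/b)) dv for t > 0. Then J_k(t) = J_k(1/t) for all t > 0; in particular J_k is a function of T = t + 1/t alone. -/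
open MeasureTheory Real

/-- Inversion maps the interval `(1 / b, b)` onto itself. -/
theorem image_inv_Ioo_one_div {b : ℝ} (hb : 0 < b) :
    (fun v : ℝ => v⁻¹) '' Set.Ioo (1 / b) b = Set.Ioo (1 / b) b := by
  have maps : ∀ v ∈ Set.Ioo (1 / b) b, v⁻¹ ∈ Set.Ioo (1 / b) b := by
    rintro v ⟨hv, hv'⟩
    have hv0 : 0 < v := (one_div_pos.2 hb).trans hv
    exact ⟨by simpa using inv_strictAnti₀ hv0 hv',
      by simpa using inv_strictAnti₀ (one_div_pos.2 hb) hv⟩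
  ext v
  exact ⟨by rintro ⟨w, hw, rfl⟩; exact maps w hw, fun hv => ⟨v⁻¹, maps v hv, inv_inv v⟩⟩

/-- The substitution `v ↦ v⁻¹` in an integral over `(1 / b, b)`. -/
theorem lintegral_Ioo_comp_inv {b : ℝ} (hb : 0 < b) (f : ℝ → ENNReal) :
    ∫⁻ v in Set.Ioo (1 / b) b, f v =
      ∫⁻ v in Set.Ioo (1 / b) b, ENNReal.ofReal (v ^ 2)⁻¹ * f v⁻¹ := by
  have hderiv : ∀ v ∈ Set.Ioo (1 / b) b,
      HasDerivWithinAt (fun v : ℝ => v⁻¹) (-(v ^ 2)⁻¹) (Set.Ioo (1 / b) b) v := fun v hv =>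
    (hasDerivAt_inv ((one_div_pos.2 hb).trans hv.1).ne').hasDerivWithinAt
  conv_lhs => rw [← image_inv_Ioo_one_div hb]
  rw [lintegral_image_eq_lintegral_abs_deriv_mul measurableSet_Ioo hderiv
    inv_injective.injOn]
  simp only [abs_neg, abs_inv, abs_pow, sq_abs]

/-- The integrand of `J` at `t` and `v⁻¹`, with the Jacobian, is the integrand at `1 / t` and `v`. -/
theorem integrand_inv {k a b t v : ℝ} (ha : 0 < a) (hb : 0 < b) (ht : 0 < t)
    (hv : v ∈ Set.Ioo (1 / b) b) :
    (v ^ 2)⁻¹ * (((b - v⁻¹) * (v⁻¹ - 1 / b) / ((v⁻¹ + t * a) * (v⁻¹ + t / a))) ^ k *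
        (t ^ k / ((b - v⁻¹) * (v⁻¹ - 1 / b)))) =
      ((b - v) * (v - 1 / b) / ((v + 1 / t * a) * (v + 1 / t / a))) ^ k *
        ((1 / t) ^ k / ((b - v) * (v - 1 / b))) := by
  have hv0 : 0 < v := (one_div_pos.2 hb).trans hv.1
  have h1 : 0 < b - v := sub_pos.2 hv.2
  have h2 : 0 < v - 1 / b := sub_pos.2 hv.1
  have hnum : (b - v⁻¹) * (v⁻¹ - 1 / b) = (b - v) * (v - 1 / b) / v ^ 2 := by
    field_simp
  have hden : (v⁻¹ + t * a) * (v⁻¹ + t / a) =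
      t ^ 2 * ((v + 1 / t * a) * (v + 1 / t / a)) / v ^ 2 := by
    field_simp
    ring
  rw [hnum, hden]
  set N := (b - v) * (v - 1 / b) with hN
  set D := (v + 1 / t * a) * (v + 1 / t / a) with hD
  have hN0 : 0 < N := by positivity
  have hD0 : 0 < D := by positivity
  have hratio : N / v ^ 2 / (t ^ 2 * D / v ^ 2) = N / D * (1 / t * (1 / t)) := by
    field_simp
  have htk : (1 / t) ^ k * t ^ k = 1 := by
    rw [← mul_rpow (by positivity) ht.le, one_div_mul_cancel ht.ne', one_rpow]
  rw [hratio, mul_rpow (by positivity) (by positivity), mul_rpow (by positivity) (by positivity)]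
  calc _ = (N / D) ^ k * (1 / t) ^ k * ((1 / t) ^ k * t ^ k) * (1 / N) := by field_simp
    _ = _ := by rw [htk]; ring

theorem J_k_symmetric (k a b : ℝ) (hk : 0 < k) (ha : 1 < a) (hb : 1 < b)
    (J : ℝ → ENNReal)
    (hJ : ∀ t : ℝ, J t =
      ∫⁻ v in Set.Ioo (1 / b) b,
        ENNReal.ofReal
          (((b - v) * (v - 1 / b) / ((v + t * a) * (v + t / a))) ^ k *
            (t ^ k / ((b - v) * (v - 1 / b))))) :
    (∀ t : ℝ, 0 < t → J t = J (1 / t)) ∧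
    ∀ t₁ t₂ : ℝ, 0 < t₁ → 0 < t₂ → t₁ + 1 / t₁ = t₂ + 1 / t₂ → J t₁ = J t₂ := by
  have hb0 : 0 < b := one_pos.trans hb
  have hsymm : ∀ t : ℝ, 0 < t → J t = J (1 / t) := by
    intro t ht
    rw [hJ t, hJ (1 / t), lintegral_Ioo_comp_inv hb0]
    refine setLIntegral_congr_fun measurableSet_Ioo fun v hv => ?_
    rw [← ENNReal.ofReal_mul (by positivity), integrand_inv (one_pos.trans ha) hb0 ht hv]
  refine ⟨hsymm, fun t₁ t₂ h₁ h₂ h => ?_⟩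
  have hfactor : (t₁ - t₂) * (t₁ * t₂ - 1) = 0 := by
    field_simp at h
    linear_combination h
  rcases mul_eq_zero.1 hfactor with h' | h'
  · rw [sub_eq_zero.1 h']
  · rw [hsymm t₁ h₁, (eq_one_div_of_mul_eq_one_right (sub_eq_zero.1 h')).symm]
end

section
/- Let A ≥ 0, B ≥ 0 and c ≥ 0. Then the function T ↦ ∫_{0}^{∞} exp(−((δ + 1/δ)·√((T + A)(T + B)) + 2T + c)) · dδ/δ is completely monotone on (0,∞). -/
open MeasureTheory Real

theorem CompletelyMonotoneOn.congr {f g : ℝ → ℝ} (hg : CompletelyMonotoneOn g)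
    (h : Set.EqOn f g (Set.Ioi 0)) : CompletelyMonotoneOn f :=
  ⟨hg.1.congr h, fun n T hT => by
    rw [iteratedDerivWithin_congr h (Set.mem_Ioi.2 hT)]
    exact hg.2 n T hT⟩

/-- The moment generating function of an a.e. nonpositive function is completely monotone as soon
as it is finite on `(0,∞)`. -/
theorem completelyMonotoneOn_mgf {Ω : Type*} [MeasurableSpace Ω] {μ : Measure Ω} {X : Ω → ℝ}
    (hX : ∀ᵐ ω ∂μ, X ω ≤ 0) (hint : ∀ t : ℝ, 0 < t → Integrable (fun ω => Real.exp (t * X ω)) μ) :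
    CompletelyMonotoneOn (ProbabilityTheory.mgf X μ) := by
  have hsub : Set.Ioi (0 : ℝ) ⊆ interior (ProbabilityTheory.integrableExpSet X μ) :=
    interior_maximal (fun t ht => hint t ht) isOpen_Ioi
  refine ⟨(ProbabilityTheory.analyticOnNhd_mgf.mono hsub).contDiffOn isOpen_Ioi.uniqueDiffOn,
    fun n T hT => ?_⟩
  rw [iteratedDerivWithin_of_isOpen isOpen_Ioi (Set.mem_Ioi.2 hT),
    ProbabilityTheory.iteratedDeriv_mgf (hsub hT), ← integral_const_mul]
  refine integral_nonneg_of_ae ?_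
  filter_upwards [hX] with ω hω
  rw [← mul_assoc, ← mul_pow]
  exact mul_nonneg (pow_nonneg (by linarith) n) (Real.exp_pos _).le

/-- The Laplace transform of a nonnegative weight `w` along a nonnegative phase `φ` is completely
monotone as soon as it converges on `(0,∞)`. -/
theorem completelyMonotoneOn_integral_exp_mul {Ω : Type*} [MeasurableSpace Ω] {μ : Measure Ω}
    {φ w : Ω → ℝ} (hw : Measurable w) (hw0 : ∀ᵐ ω ∂μ, 0 ≤ w ω) (hφ : ∀ᵐ ω ∂μ, 0 ≤ φ ω)
    (hint : ∀ t : ℝ, 0 < t → Integrable (fun ω => w ω * Real.exp (-(t * φ ω))) μ) :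
    CompletelyMonotoneOn (fun t => ∫ ω, w ω * Real.exp (-(t * φ ω)) ∂μ) := by
  have key : ∀ t : ℝ, (fun ω => w ω * Real.exp (-(t * φ ω))) =ᵐ[μ]
      fun ω => (w ω).toNNReal • Real.exp (t * -φ ω) := fun t => by
    filter_upwards [hw0] with ω hω
    rw [NNReal.smul_def, Real.coe_toNNReal _ hω, smul_eq_mul, mul_neg]
  refine (completelyMonotoneOn_mgf (X := fun ω => -φ ω)
    (μ := μ.withDensity fun ω => ((w ω).toNNReal : ENNReal)) ?_ fun t ht => ?_).congr fun t _ => ?_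
  · filter_upwards [(withDensity_absolutelyContinuous μ _).ae_le hφ] with ω hω
    linarith
  · rw [integrable_withDensity_iff_integrable_smul hw.real_toNNReal]
    exact (hint t ht).congr (key t)
  · rw [ProbabilityTheory.mgf, integral_withDensity_eq_integral_smul hw.real_toNNReal]
    exact integral_congr_ae (key t)

theorem inv_mul_exp_neg_mul_inv_le {t : ℝ} (ht : 0 < t) (u : ℝ) :
    u⁻¹ * Real.exp (-(t * u⁻¹)) ≤ t⁻¹ := by
  rw [Real.exp_neg, ← div_eq_mul_inv, div_le_iff₀ (Real.exp_pos _), inv_mul_eq_div,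
    le_div_iff₀ ht]
  linarith [Real.add_one_le_exp (t * u⁻¹)]

/-- Rescaling `δ` by `√(a / b)` makes the exponent of a Bessel-type integral linear in `a`, `b`. -/
theorem integral_exp_sqrt_mul_inv {a b : ℝ} (ha : 0 < a) (hb : 0 < b) (k : ℝ) :
    ∫ δ in Set.Ioi (0 : ℝ), Real.exp (-((δ + 1 / δ) * Real.sqrt (a * b) + k)) * δ⁻¹ =
      ∫ u in Set.Ioi (0 : ℝ), Real.exp (-(u * a + b * u⁻¹ + k)) * u⁻¹ := by
  have hp : 0 < Real.sqrt a := Real.sqrt_pos.2 ha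
  have hq : 0 < Real.sqrt b := Real.sqrt_pos.2 hb
  have hr : 0 < Real.sqrt a / Real.sqrt b := div_pos hp hq
  have h := integral_comp_mul_left_Ioi'
    (fun δ => Real.exp (-((δ + 1 / δ) * Real.sqrt (a * b) + k)) * δ⁻¹) 0 hr
  rw [mul_zero] at h
  rw [← h, smul_eq_mul, ← integral_const_mul]
  refine setIntegral_congr_fun measurableSet_Ioi fun u (hu : 0 < u) => ?_
  have e : (Real.sqrt a / Real.sqrt b * u + 1 / (Real.sqrt a / Real.sqrt b * u)) *
      Real.sqrt (a * b) = u * a + b * u⁻¹ := by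
    rw [Real.sqrt_mul ha.le]
    conv_rhs => rw [← Real.sq_sqrt ha.le, ← Real.sq_sqrt hb.le]
    field_simp
  simp only [e]
  field_simp

theorem exp_integral_CM (A B c : ℝ) (hA : 0 ≤ A) (hB : 0 ≤ B) (hc : 0 ≤ c) :
    CompletelyMonotoneOn (fun T =>
      ∫ δ in Set.Ioi (0 : ℝ),
        Real.exp (-((δ + 1 / δ) * Real.sqrt ((T + A) * (T + B)) + 2 * T + c)) * δ⁻¹) := by
  have hw0 : ∀ u : ℝ, 0 < u → 0 ≤ u⁻¹ * Real.exp (-(u * A + B * u⁻¹ + c)) := fun u hu => by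
    positivity
  refine (completelyMonotoneOn_integral_exp_mul (μ := volume.restrict (Set.Ioi 0))
    (φ := fun u => u + u⁻¹ + 2) (w := fun u => u⁻¹ * Real.exp (-(u * A + B * u⁻¹ + c)))
    (by fun_prop) ?_ ?_ fun t ht => ?_).congr fun T hT => ?_
  · filter_upwards [ae_restrict_mem measurableSet_Ioi] with u hu using hw0 u hu
  · filter_upwards [ae_restrict_mem measurableSet_Ioi] with u (hu : 0 < u)
    positivity
  · refine ((exp_neg_integrableOn_Ioi 0 ht).const_mul t⁻¹).mono'
      (by fun_prop : Measurable _).aestronglyMeasurable ?_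
    filter_upwards [ae_restrict_mem measurableSet_Ioi] with u (hu : 0 < u)
    rw [Real.norm_of_nonneg (mul_nonneg (hw0 u hu) (Real.exp_pos _).le)]
    have h0 : 0 ≤ u * A + B * u⁻¹ + c := by positivity
    calc u⁻¹ * Real.exp (-(u * A + B * u⁻¹ + c)) * Real.exp (-(t * (u + u⁻¹ + 2)))
        = u⁻¹ * Real.exp (-(u * A + B * u⁻¹ + c) + -(t * (u + u⁻¹ + 2))) := by
          rw [mul_assoc, ← Real.exp_add]
      _ ≤ u⁻¹ * Real.exp (-(t * u⁻¹) + -t * u) := by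
          refine mul_le_mul_of_nonneg_left (Real.exp_le_exp.2 ?_) (inv_pos.2 hu).le
          linarith
      _ = u⁻¹ * Real.exp (-(t * u⁻¹)) * Real.exp (-t * u) := by
          rw [mul_assoc, ← Real.exp_add]
      _ ≤ t⁻¹ * Real.exp (-t * u) := by
          gcongr
          exact inv_mul_exp_neg_mul_inv_le ht u
  · have hT' : 0 < T := hT
    simp only [add_assoc _ (2 * T) c]
    rw [integral_exp_sqrt_mul_inv (by linarith) (by linarith)]
    refine integral_congr_ae (ae_of_all _ fun u => ?_)
    simp only
    rw [mul_comm, mul_assoc, ← Real.exp_add]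
    congr 2
    ring
end
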